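/- For every real m > 1, the number of primes not exceeding m is at most 1.25506·m / log m (natural logarithm). -/

import Mathlib

namespace PCU

/-- Force evaluation of a natural number before passing it on. -/
def force {α : Type} (x : ℕ) (f : ℕ → α) : α :=
  match x with
  | 0 => f 0
  | k + 1 => f (k + 1)

theorem force_eq {α : Type} (x : ℕ) (f : ℕ → α) : force x f = f x := by
  cases x <;> rfl

/-- The numerical test at `n` with `c` primes up to `n`. -/
def good (n c : ℕ) : Bool :=
  Nat.ble (Nat.pow n 545)
    (Nat.pow 2 (Nat.div (Nat.mul n 684007700000000000) (Nat.mul c 693147180800000)))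

/-- State `(n, c, Q)`: `c` is the number of primes up to `n`, `Q` their product. -/
def step (s : ℕ × ℕ × ℕ) : ℕ × ℕ × ℕ :=
  match s with
  | (n, c, Q) =>
    force (Nat.succ n) fun m =>
      cond (Nat.beq (Nat.gcd (Nat.mod Q m) m) 1)
        (force (Nat.succ c) fun d =>
          cond (good m d) (force (Nat.mul Q m) fun R => (m, d, R)) (m, d, 0))
        (cond (good m c) (m, c, Q) (m, c, 0))

def iter : ℕ → ℕ × ℕ × ℕ → ℕ × ℕ × ℕ
  | 0, s => step s
  | k + 1, s =>
    match iter k s with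
    | (n, c, Q) => force n fun n => force c fun c => force Q fun Q => iter k (n, c, Q)

def fin (s : ℕ × ℕ × ℕ) : Bool :=
  match s with
  | (n, c, Q) => and (Nat.beq n 32769) (and (Nat.ble c 3512) (Nat.ble (Nat.pow 2 46900) Q))

theorem fin_true : fin (iter 15 (1, 0, 1)) = true := by decide +kernel

theorem primorial_succ_prime {n : ℕ} (h : (n + 1).Prime) :
    primorial (n + 1) = primorial n * (n + 1) := by
  unfold primorial
  rw [Finset.range_add_one, Finset.filter_insert, if_pos h, Finset.prod_insert (by simp), mul_comm]

theorem primorial_succ_not {n : ℕ} (h : ¬ (n + 1).Prime) :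
    primorial (n + 1) = primorial n := by
  unfold primorial
  rw [Finset.range_add_one, Finset.filter_insert, if_neg h]

theorem pc_succ_prime {n : ℕ} (h : (n + 1).Prime) :
    Nat.primeCounting (n + 1) = Nat.primeCounting n + 1 := by
  simp [Nat.primeCounting, Nat.primeCounting', Nat.count_succ _ (n + 1), h]

theorem pc_succ_not {n : ℕ} (h : ¬ (n + 1).Prime) :
    Nat.primeCounting (n + 1) = Nat.primeCounting n := by
  simp [Nat.primeCounting, Nat.primeCounting', Nat.count_succ _ (n + 1), h]

theorem prime_iff_gcd {n : ℕ} (hn : 1 ≤ n) :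
    (n + 1).Prime ↔ Nat.gcd (primorial n % (n + 1)) (n + 1) = 1 := by
  have e : Nat.gcd (primorial n % (n + 1)) (n + 1) = Nat.gcd (n + 1) (primorial n) :=
    (Nat.gcd_rec _ _).symm
  rw [e]
  constructor
  · intro h
    refine Nat.Coprime.prod_right ?_
    intro p hp
    simp only [Finset.mem_filter, Finset.mem_range] at hp
    rw [Nat.coprime_primes h hp.2]
    omega
  · intro h
    by_contra hc
    have h2 : n + 1 ≠ 1 := by omega
    have hp := Nat.minFac_prime h2
    have hlt : (n + 1).minFac < n + 1 := by
      rcases lt_or_eq_of_le (Nat.minFac_le (n := n + 1) (by omega)) with h | h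
      · exact h
      · exact absurd (h ▸ hp) hc
    have hd : (n + 1).minFac ∣ primorial n := by
      refine Finset.dvd_prod_of_mem (fun p => p) ?_
      simp only [Finset.mem_filter, Finset.mem_range]
      exact ⟨hlt, hp⟩
    have := Nat.dvd_gcd (Nat.minFac_dvd (n + 1)) hd
    rw [h] at this
    exact hp.one_lt.ne' (Nat.dvd_one.mp this)

/-- Invariant of the computation. -/
def Inv (s : ℕ × ℕ × ℕ) : Prop :=
  s.2.2 ≠ 0 → 1 ≤ s.1 ∧ s.2.1 = Nat.primeCounting s.1 ∧ s.2.2 = primorial s.1 ∧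
    ∀ k, 2 ≤ k → k ≤ s.1 → good k (Nat.primeCounting k) = true

theorem inv_step {s : ℕ × ℕ × ℕ} (h : Inv s) : Inv (step s) := by
  obtain ⟨n, c, Q⟩ := s
  simp only [step, force_eq]
  by_cases hQ : Q = 0
  · subst hQ
    intro hne
    exfalso
    revert hne
    have : Nat.mul 0 n.succ = 0 := Nat.zero_mul _
    rw [this]
    cases Nat.beq (Nat.gcd (Nat.mod 0 n.succ) n.succ) 1 <;> cases good n.succ c <;>
      cases good n.succ c.succ <;> simp
  · obtain ⟨hn, hc, hQ', hg⟩ := h hQ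
    simp only at hn hc hQ' hg
    have key := prime_iff_gcd hn
    rw [← hQ'] at key
    by_cases hp : (n + 1).Prime
    · have h1 : Nat.beq (Nat.gcd (Nat.mod Q n.succ) n.succ) 1 = true := Nat.beq_eq.mpr (key.mp hp)
      rw [h1, cond_true]
      by_cases hgd : good n.succ c.succ = true
      · rw [hgd, cond_true]
        intro _
        refine ⟨Nat.succ_le_succ (Nat.zero_le _), ?_, ?_, ?_⟩
        · simp [pc_succ_prime hp, hc]
        · simp only [Nat.succ_eq_add_one, primorial_succ_prime hp, ← hQ']; rfl
        · intro k h2 hk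
          simp only at hk
          rcases Nat.lt_or_eq_of_le hk with h | h
          · exact hg k h2 (Nat.lt_succ_iff.mp h)
          · rw [h, Nat.succ_eq_add_one, pc_succ_prime hp, ← hc]; exact hgd
      · rw [Bool.not_eq_true] at hgd
        rw [hgd, cond_false]
        intro h; exact absurd rfl h
    · have h1 : Nat.beq (Nat.gcd (Nat.mod Q n.succ) n.succ) 1 = false := by
        rw [← Bool.not_eq_true, Nat.beq_eq]; exact fun h => hp (key.mpr h)
      rw [h1, cond_false]
      by_cases hgd : good n.succ c = true
      · rw [hgd, cond_true]
        intro _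
        refine ⟨Nat.succ_le_succ (Nat.zero_le _), ?_, ?_, ?_⟩
        · simp [pc_succ_not hp, hc]
        · simp only [Nat.succ_eq_add_one, primorial_succ_not hp, ← hQ']
        · intro k h2 hk
          simp only at hk
          rcases Nat.lt_or_eq_of_le hk with h | h
          · exact hg k h2 (Nat.lt_succ_iff.mp h)
          · rw [h, Nat.succ_eq_add_one, pc_succ_not hp, ← hc]; exact hgd
      · rw [Bool.not_eq_true] at hgd
        rw [hgd, cond_false]
        intro h; exact absurd rfl h

theorem inv_iter (k : ℕ) : ∀ {s : ℕ × ℕ × ℕ}, Inv s → Inv (iter k s) := by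
  induction k with
  | zero => intro s h; exact inv_step h
  | succ k ih =>
    intro s h
    simp only [iter, force_eq]
    exact ih (ih h)

theorem inv_start : Inv (1, 0, 1) := by
  intro _
  refine ⟨le_refl _, by simp, primorial_one.symm, ?_⟩
  intro k h2 h1
  simp only at h1
  omega

theorem computed :
    (∀ k, 2 ≤ k → k ≤ 32768 → good k (Nat.primeCounting k) = true) ∧
    Nat.primeCounting 32768 ≤ 3512 ∧ 2 ^ 46900 ≤ primorial 32768 := by
  have hi := inv_iter 15 inv_start
  have hf := fin_true
  revert hi hf
  generalize iter 15 (1, 0, 1) = s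
  obtain ⟨n, c, Q⟩ := s
  intro hi hf
  simp only [fin, Bool.and_eq_true, Nat.beq_eq, Nat.ble_eq] at hf
  obtain ⟨h1, h2, h3⟩ := hf
  have h3' : 2 ^ 46900 ≤ Q := h3
  clear h3
  have hQ : Q ≠ 0 := by
    have : 0 < 2 ^ 46900 := Nat.pow_pos (by norm_num)
    exact (lt_of_lt_of_le this h3').ne'
  obtain ⟨-, hc, hQ', hg⟩ := hi hQ
  simp only at hc hQ' hg
  have hnp : ¬ (32768 + 1).Prime := by norm_num
  rw [h1] at hc hQ' hg
  refine ⟨fun k hk hk' => hg k hk (by omega), ?_, ?_⟩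
  · rw [← pc_succ_not hnp]; exact hc ▸ h2
  · rw [← primorial_succ_not hnp, ← hQ']; exact h3'

open Finset

theorem log_factorial_eq (N : ℕ) : ∀ X : ℕ, X ≤ N →
    Real.log (X.factorial : ℝ) =
      ∑ d ∈ Ioc 0 N, ArithmeticFunction.vonMangoldt d * ((X / d : ℕ) : ℝ) := by
  intro X
  induction X with
  | zero => intro _; simp
  | succ X ih =>
    intro hX
    have hne : ((X : ℝ) + 1) ≠ 0 := by positivity
    have hne' : (X.factorial : ℝ) ≠ 0 := by positivity
    rw [Nat.factorial_succ]
    push_cast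
    rw [Real.log_mul hne hne', ih (by omega)]
    have h1 : Real.log ((X : ℝ) + 1) =
        ∑ d ∈ Ioc 0 N, if d ∣ X + 1 then ArithmeticFunction.vonMangoldt d else 0 := by
      have := ArithmeticFunction.vonMangoldt_sum (n := X + 1)
      push_cast at this
      rw [← this, ← Finset.sum_filter]
      refine Finset.sum_congr ?_ (fun _ _ => rfl)
      ext d
      simp only [Nat.mem_divisors, Finset.mem_filter, Finset.mem_Ioc]
      constructor
      · rintro ⟨h, _⟩
        exact ⟨⟨Nat.pos_of_dvd_of_pos h (by omega), (Nat.le_of_dvd (by omega) h).trans hX⟩, h⟩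
      · rintro ⟨_, h⟩
        exact ⟨h, by omega⟩
    rw [h1, ← Finset.sum_add_distrib]
    refine Finset.sum_congr rfl (fun d _ => ?_)
    rw [Nat.succ_div]
    split_ifs <;> push_cast <;> ring

theorem psi_step (X : ℕ) :
    Chebyshev.psi X ≤ Chebyshev.psi ((X / 6 : ℕ) : ℝ) +
      (Real.log (X.factorial : ℝ) - Real.log ((X / 2).factorial : ℝ)
        - Real.log ((X / 3).factorial : ℝ) - Real.log ((X / 5).factorial : ℝ)
        + Real.log ((X / 30).factorial : ℝ)) := by
  rw [log_factorial_eq X X le_rfl, log_factorial_eq X (X / 2) (Nat.div_le_self _ _),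
    log_factorial_eq X (X / 3) (Nat.div_le_self _ _),
    log_factorial_eq X (X / 5) (Nat.div_le_self _ _),
    log_factorial_eq X (X / 30) (Nat.div_le_self _ _)]
  have h6 : Chebyshev.psi ((X / 6 : ℕ) : ℝ) =
      ∑ d ∈ Ioc 0 X, if d ≤ X / 6 then ArithmeticFunction.vonMangoldt d else 0 := by
    rw [Chebyshev.psi, Nat.floor_natCast, ← Finset.sum_filter]
    refine Finset.sum_congr ?_ (fun _ _ => rfl)
    ext d
    simp only [Finset.mem_filter, Finset.mem_Ioc]
    have := Nat.div_le_self X 6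
    constructor
    · rintro ⟨h, h'⟩; exact ⟨⟨h, h'.trans this⟩, h'⟩
    · rintro ⟨⟨h, _⟩, h'⟩; exact ⟨h, h'⟩
  rw [h6, Chebyshev.psi, Nat.floor_natCast, ← Finset.sum_sub_distrib, ← Finset.sum_sub_distrib,
    ← Finset.sum_sub_distrib, ← Finset.sum_add_distrib, ← Finset.sum_add_distrib]
  refine Finset.sum_le_sum (fun d hd => ?_)
  have hL : 0 ≤ ArithmeticFunction.vonMangoldt d := ArithmeticFunction.vonMangoldt_nonneg
  rw [Finset.mem_Ioc] at hd
  have e2 : X / 2 / d = X / d / 2 := Nat.div_right_comm _ _ _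
  have e3 : X / 3 / d = X / d / 3 := Nat.div_right_comm _ _ _
  have e5 : X / 5 / d = X / d / 5 := Nat.div_right_comm _ _ _
  have e30 : X / 30 / d = X / d / 30 := Nat.div_right_comm _ _ _
  rw [e2, e3, e5, e30]
  have hy1 : 1 ≤ X / d := (Nat.one_le_div_iff hd.1).mpr hd.2
  have hy6 : ¬ d ≤ X / 6 → X / d < 6 := by
    intro h
    rw [Nat.div_lt_iff_lt_mul hd.1]
    omega
  generalize X / d = y at *
  have key : (if d ≤ X / 6 then 0 else 1 : ℤ) ≤
      (y : ℤ) - (y / 2 : ℕ) - (y / 3 : ℕ) - (y / 5 : ℕ) + (y / 30 : ℕ) := by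
    split_ifs with h
    · omega
    · have := hy6 h
      omega
  have keyR : (if d ≤ X / 6 then 0 else 1 : ℝ) ≤
      (y : ℝ) - (y / 2 : ℕ) - (y / 3 : ℕ) - (y / 5 : ℕ) + (y / 30 : ℕ) := by
    split_ifs at key ⊢ with h
    all_goals
      have := (Int.cast_le (R := ℝ)).mpr key
      simp only [Int.cast_add, Int.cast_sub, Int.cast_natCast, Int.cast_zero, Int.cast_one] at this
      exact this
  have := mul_le_mul_of_nonneg_left keyR hL
  split_ifs at this ⊢ <;> linarith

theorem fact_lower (n : ℕ) :
    (n : ℝ) * Real.log ((n : ℝ) + 1) - n ≤ Real.log (n.factorial : ℝ) := by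
  induction n with
  | zero => simp
  | succ n ih =>
    have hn : (0 : ℝ) < (n : ℝ) + 1 := by positivity
    rw [Nat.factorial_succ]
    push_cast
    rw [Real.log_mul hn.ne' (by positivity)]
    have h := Real.log_le_sub_one_of_pos (x := ((n : ℝ) + 1 + 1) / (n + 1)) (by positivity)
    rw [Real.log_div (by positivity) hn.ne'] at h
    have h2 : ((n : ℝ) + 1 + 1) / (n + 1) - 1 = 1 / (n + 1) := by field_simp; ring
    rw [h2, le_div_iff₀ hn] at h
    nlinarith

theorem fact_upper (n : ℕ) (h1 : 1 ≤ n) :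
    Real.log (n.factorial : ℝ) ≤ ((n : ℝ) + 1) * Real.log n - n + 1 := by
  induction n, h1 using Nat.le_induction with
  | base => simp
  | succ n hn1 ih =>
    have hn0 : (0 : ℝ) < (n : ℝ) := by exact_mod_cast hn1
    have hn : (0 : ℝ) < (n : ℝ) + 1 := by positivity
    rw [Nat.factorial_succ]
    push_cast
    rw [Real.log_mul hn.ne' (by positivity)]
    have h := Real.log_le_sub_one_of_pos (x := (n : ℝ) / (n + 1)) (by positivity)
    rw [Real.log_div hn0.ne' hn.ne'] at h
    have h2 : (n : ℝ) / (n + 1) - 1 = (-1) / (n + 1) := by field_simp; ring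
    rw [h2, le_div_iff₀ hn] at h
    nlinarith

theorem fact_lower_real (n : ℕ) (y : ℝ) (hy : Real.exp 1 ≤ y) (h2 : y ≤ n + 1) :
    (y - 1) * Real.log y - y + 1 ≤ Real.log (n.factorial : ℝ) := by
  have hy0 : 0 < y := (Real.exp_pos 1).trans_le hy
  have hl : 1 ≤ Real.log y := (Real.le_log_iff_exp_le hy0).mpr hy
  have hl2 : Real.log y ≤ Real.log ((n : ℝ) + 1) := Real.log_le_log hy0 h2
  have h3 := fact_lower n
  have hn : (0 : ℝ) ≤ n := Nat.cast_nonneg n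
  nlinarith [mul_le_mul_of_nonneg_left hl2 hn, mul_nonneg (sub_nonneg.mpr h2) (sub_nonneg.mpr hl)]

theorem fact_upper_real (n : ℕ) (y : ℝ) (h1 : 1 ≤ n) (hn : (n : ℝ) ≤ y) (h2 : y ≤ n + 1) :
    Real.log (n.factorial : ℝ) ≤ (y + 1) * Real.log y - y + 1 := by
  have hn0 : (1 : ℝ) ≤ (n : ℝ) := by exact_mod_cast h1
  have hy0 : 0 < y := by linarith
  have h3 := fact_upper n h1
  have hly : 0 ≤ Real.log y := Real.log_nonneg (by linarith)
  have h := Real.log_le_sub_one_of_pos (x := (n : ℝ) / y) (by positivity)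
  rw [Real.log_div (by positivity) hy0.ne'] at h
  have h4 : (n : ℝ) / y - 1 = (n - y) / y := by field_simp
  rw [h4] at h
  have h5 : (y - n) ≤ (n + 1) * (Real.log y - Real.log n) := by
    have h6 : (y - n) / y ≤ Real.log y - Real.log n := by
      have : (n - y) / y = - ((y - n) / y) := by ring
      linarith
    have h7 : (y - n) ≤ (n + 1) * ((y - n) / y) := by
      rw [← mul_div_assoc, le_div_iff₀ hy0]
      nlinarith
    have := mul_le_mul_of_nonneg_left h6 (show (0 : ℝ) ≤ (n : ℝ) + 1 by positivity)
    linarith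
  nlinarith [mul_nonneg (sub_nonneg.mpr hn) hly]

theorem log3_upper : Real.log 3 ≤ 65 / 41 * Real.log 2 := by
  have h : Real.log ((3 : ℝ) ^ 41) ≤ Real.log ((2 : ℝ) ^ 65) :=
    Real.log_le_log (by norm_num) (by norm_num)
  rw [Real.log_pow, Real.log_pow] at h
  push_cast at h
  linarith

theorem log3_lower : 19 / 12 * Real.log 2 ≤ Real.log 3 := by
  have h : Real.log ((2 : ℝ) ^ 19) ≤ Real.log ((3 : ℝ) ^ 12) :=
    Real.log_le_log (by norm_num) (by norm_num)
  rw [Real.log_pow, Real.log_pow] at h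
  push_cast at h
  linarith

theorem log5_upper : Real.log 5 ≤ 72 / 31 * Real.log 2 := by
  have h : Real.log ((5 : ℝ) ^ 31) ≤ Real.log ((2 : ℝ) ^ 72) :=
    Real.log_le_log (by norm_num) (by norm_num)
  rw [Real.log_pow, Real.log_pow] at h
  push_cast at h
  linarith

theorem log5_lower : 2 * Real.log 2 ≤ Real.log 5 := by
  have h : Real.log ((2 : ℝ) ^ 2) ≤ Real.log (5 : ℝ) :=
    Real.log_le_log (by norm_num) (by norm_num)
  rw [Real.log_pow] at h
  push_cast at h
  linarith

theorem div_bounds (X k : ℕ) (hk : 0 < k) :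
    ((X / k : ℕ) : ℝ) ≤ (X : ℝ) / k ∧ (X : ℝ) / k ≤ ((X / k : ℕ) : ℝ) + 1 := by
  have hk' : (0 : ℝ) < k := by exact_mod_cast hk
  refine ⟨Nat.cast_div_le, ?_⟩
  rw [div_le_iff₀ hk']
  have := Nat.lt_div_mul_add hk (a := X)
  have h2 : X ≤ (X / k + 1) * k := by nlinarith
  exact_mod_cast h2

theorem alpha_bound (X : ℕ) (hX : 30 ≤ X) :
    Real.log (X.factorial : ℝ) - Real.log ((X / 2).factorial : ℝ)
        - Real.log ((X / 3).factorial : ℝ) - Real.log ((X / 5).factorial : ℝ)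
        + Real.log ((X / 30).factorial : ℝ) ≤ 0.9215 * X + 5 * Real.log X - 7 := by
  have hXR : (30 : ℝ) ≤ X := by exact_mod_cast hX
  have hX0 : (0 : ℝ) < X := by linarith
  have he : Real.exp 1 ≤ 3 := by linarith [Real.exp_one_lt_d9]
  have u1 := fact_upper_real X X (by omega) le_rfl (by linarith)
  have u30 := fact_upper_real (X / 30) ((X : ℝ) / (30 : ℕ)) (by omega)
    (div_bounds X 30 (by norm_num)).1 (div_bounds X 30 (by norm_num)).2
  have l2 := fact_lower_real (X / 2) ((X : ℝ) / (2 : ℕ))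
    (by push_cast; linarith) (div_bounds X 2 (by norm_num)).2
  have l3 := fact_lower_real (X / 3) ((X : ℝ) / (3 : ℕ))
    (by push_cast; linarith) (div_bounds X 3 (by norm_num)).2
  have l5 := fact_lower_real (X / 5) ((X : ℝ) / (5 : ℕ))
    (by push_cast; linarith) (div_bounds X 5 (by norm_num)).2
  push_cast at u30 l2 l3 l5
  rw [Real.log_div hX0.ne' (by norm_num)] at u30 l2 l3 l5
  have e30 : Real.log 30 = Real.log 2 + Real.log 3 + Real.log 5 := by
    rw [← Real.log_mul (by norm_num) (by norm_num), ← Real.log_mul (by norm_num) (by norm_num)]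
    norm_num
  rw [e30] at u30
  have a1 := log3_upper
  have a2 := log5_upper
  have a3 := log3_lower
  have a4 := log5_lower
  have b1 := Real.log_two_lt_d9
  have b2 := Real.log_two_gt_d9
  have hA : 7 / 15 * Real.log 2 + 3 / 10 * Real.log 3 + 1 / 6 * Real.log 5 ≤ 0.9215 := by
    linarith
  have hA' := mul_le_mul_of_nonneg_left hA hX0.le
  linarith

theorem psi_bound (X : ℕ) :
    Chebyshev.psi X ≤ 1.1058 * X + 1.4 * Real.log X ^ 2 + 162 := by
  induction X using Nat.strong_induction_on with
  | _ X ih =>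
    by_cases hX : X < 30
    · have h := Chebyshev.psi_le_const_mul_self (x := (X : ℝ)) (Nat.cast_nonneg _)
      have h4 : Real.log 4 = 2 * Real.log 2 := by
        rw [show (4 : ℝ) = 2 ^ 2 by norm_num, Real.log_pow]; norm_num
      rw [h4] at h
      have b1 := Real.log_two_lt_d9
      have hXR : (X : ℝ) ≤ 30 := by exact_mod_cast hX.le
      have hX0 : (0 : ℝ) ≤ X := Nat.cast_nonneg _
      nlinarith [sq_nonneg (Real.log X)]
    · push Not at hX
      have h1 := psi_step X
      have h2 := alpha_bound X hX
      have h3 := ih (X / 6) (by omega)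
      have hq := (div_bounds X 6 (by norm_num)).1
      push_cast at hq
      have hXR : (30 : ℝ) ≤ X := by exact_mod_cast hX
      have hq1 : (1 : ℝ) ≤ ((X / 6 : ℕ) : ℝ) := by
        have : 1 ≤ X / 6 := by omega
        exact_mod_cast this
      have hl0 := Real.log_nonneg hq1
      have hl := Real.log_le_log (by linarith) hq
      rw [Real.log_div (by linarith) (by norm_num)] at hl
      have e6 : Real.log 6 = Real.log 2 + Real.log 3 := by
        rw [← Real.log_mul (by norm_num) (by norm_num)]
        norm_num
      have a1 := log3_upper
      have a3 := log3_lower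
      have b1 := Real.log_two_lt_d9
      have b2 := Real.log_two_gt_d9
      have c1 : 1.79 ≤ Real.log 6 := by rw [e6]; linarith
      have c2 : Real.log 6 ≤ 1.8 := by rw [e6]; linarith
      have hL0 : 0 ≤ Real.log X := Real.log_nonneg (by linarith)
      have hs : Real.log ((X / 6 : ℕ) : ℝ) ^ 2 ≤ (Real.log X - Real.log 6) ^ 2 :=
        pow_le_pow_left₀ hl0 hl 2
      have hm : 1.79 * Real.log X ≤ Real.log 6 * Real.log X := mul_le_mul_of_nonneg_right c1 hL0
      have hm2 : Real.log 6 ^ 2 ≤ 1.8 ^ 2 := pow_le_pow_left₀ (by linarith) c2 2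
      have hs2 : Real.log ((X / 6 : ℕ) : ℝ) ^ 2 ≤
          Real.log X ^ 2 - 2 * (Real.log 6 * Real.log X) + Real.log 6 ^ 2 := by linarith
      linarith

theorem good_real {n c : ℕ} (hn : 2 ≤ n) (hc : 1 ≤ c) (h : good n c = true) :
    (c : ℝ) * Real.log n ≤ 1.25506 * n := by
  rw [good, Nat.ble_eq] at h
  have h' : n ^ 545 ≤ 2 ^ (n * 684007700000000000 / (c * 693147180800000)) := h
  have hn0 : (0 : ℝ) < n := by exact_mod_cast (by omega : 0 < n)
  have hc0 : (0 : ℝ) < c := by exact_mod_cast hc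
  have hR : (n : ℝ) ^ 545 ≤ 2 ^ (n * 684007700000000000 / (c * 693147180800000)) := by
    exact_mod_cast h'
  have hl := Real.log_le_log (by positivity) hR
  rw [Real.log_pow, Real.log_pow] at hl
  have hd : ((n * 684007700000000000 / (c * 693147180800000) : ℕ) : ℝ) ≤
      ((n * 684007700000000000 : ℕ) : ℝ) / ((c * 693147180800000 : ℕ) : ℝ) := Nat.cast_div_le
  have hd0 : (0 : ℝ) ≤ ((n * 684007700000000000 / (c * 693147180800000) : ℕ) : ℝ) :=
    Nat.cast_nonneg _
  generalize (n * 684007700000000000 / (c * 693147180800000)) = b at hl hd hd0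
  push_cast at hl hd
  rw [le_div_iff₀ (by positivity)] at hd
  have b1 := Real.log_two_lt_d9
  have hm := mul_le_mul_of_nonneg_left b1.le hd0
  have hm2 := mul_le_mul_of_nonneg_left (hl.trans hm) hc0.le
  nlinarith

/-- `t / log t` is monotone for `t ≥ e`. -/
theorem div_log_mono {a b : ℝ} (ha : Real.exp 1 ≤ a) (hab : a ≤ b) :
    a * Real.log b ≤ b * Real.log a := by
  have h := Real.log_div_self_antitoneOn (show a ∈ {x | Real.exp 1 ≤ x} from ha)
    (show b ∈ {x | Real.exp 1 ≤ x} from ha.trans hab) hab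
  have ha0 : 0 < a := (Real.exp_pos 1).trans_le ha
  simp only at h
  rw [div_le_div_iff₀ (by linarith) ha0] at h
  linarith

theorem small_case (m : ℝ) (hm : 1 < m) (hm2 : m ≤ 32768) :
    (Nat.primeCounting ⌊m⌋₊ : ℝ) * Real.log m ≤ 1.25506 * m := by
  have hm0 : 0 < m := by linarith
  rcases lt_or_ge m 3 with h3 | h3
  · have hf : ⌊m⌋₊ ≤ 2 := by
      have : ⌊m⌋₊ < 3 := (Nat.floor_lt hm0.le).mpr (by exact_mod_cast h3)
      omega
    have hp : Nat.primeCounting ⌊m⌋₊ ≤ 1 :=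
      (Nat.monotone_primeCounting hf).trans (by decide)
    have hpR : (Nat.primeCounting ⌊m⌋₊ : ℝ) ≤ 1 := by exact_mod_cast hp
    have hl := Real.log_le_sub_one_of_pos hm0
    have hl0 := Real.log_nonneg hm.le
    nlinarith
  · have hn3 : 3 ≤ ⌊m⌋₊ := Nat.le_floor (by exact_mod_cast h3)
    have hle : (⌊m⌋₊ : ℝ) ≤ m := Nat.floor_le hm0.le
    have hn : ⌊m⌋₊ ≤ 32768 := by exact_mod_cast hle.trans hm2
    have hg := computed.1 _ (by omega) hn
    have hc : 1 ≤ Nat.primeCounting ⌊m⌋₊ := by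
      have := Nat.monotone_primeCounting (show 2 ≤ ⌊m⌋₊ by omega)
      have h2 : Nat.primeCounting 2 = 1 := by decide
      omega
    have h := good_real (by omega) hc hg
    generalize ⌊m⌋₊ = n at *
    have hn3R : (3 : ℝ) ≤ n := by exact_mod_cast hn3
    have hmono := div_log_mono (a := n) (b := m) (by linarith [Real.exp_one_lt_d9]) hle
    have hc0 : (0 : ℝ) ≤ (Nat.primeCounting n : ℝ) := Nat.cast_nonneg _
    have h1 := mul_le_mul_of_nonneg_left hmono hc0
    have h2 := mul_le_mul_of_nonneg_left h hm0.le
    have : (n : ℝ) * ((Nat.primeCounting n : ℝ) * Real.log m) ≤ n * (1.25506 * m) := by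
      linarith
    exact le_of_mul_le_mul_left this (by linarith)

theorem log_x0 : Real.log 32768 = 15 * Real.log 2 := by
  rw [show (32768 : ℝ) = 2 ^ 15 by norm_num, Real.log_pow]; norm_num

theorem theta_bound (t : ℝ) (ht : 32768 ≤ t) : Chebyshev.theta t ≤ 1.1155 * t := by
  have h1 := Chebyshev.theta_le_psi t
  rw [Chebyshev.psi_eq_psi_coe_floor] at h1
  have h2 := psi_bound ⌊t⌋₊
  have ht0 : 0 < t := by linarith
  have hle : (⌊t⌋₊ : ℝ) ≤ t := Nat.floor_le ht0.le
  have hf1 : (1 : ℝ) ≤ (⌊t⌋₊ : ℝ) := by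
    have : 1 ≤ ⌊t⌋₊ := Nat.le_floor (by push_cast; linarith)
    exact_mod_cast this
  have hl : Real.log (⌊t⌋₊ : ℝ) ^ 2 ≤ Real.log t ^ 2 :=
    pow_le_pow_left₀ (Real.log_nonneg hf1) (Real.log_le_log (by linarith) hle) 2
  set s := Real.sqrt (t / 32768) with hs
  have hs2 : s ^ 2 = t / 32768 := Real.sq_sqrt (by positivity)
  have hs1 : 1 ≤ s := Real.one_le_sqrt.mpr (by linarith)
  have hlog : Real.log t = 15 * Real.log 2 + 2 * Real.log s := by
    have : t = 32768 * s ^ 2 := by rw [hs2]; ring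
    conv_lhs => rw [this]
    rw [Real.log_mul (by norm_num) (by positivity), log_x0, Real.log_pow]
    norm_num
  have hls := Real.log_le_sub_one_of_pos (show 0 < s by linarith)
  have b1 := Real.log_two_lt_d9
  have b2 := Real.log_two_gt_d9
  have hlt : Real.log t ≤ 10.4 * s := by
    rw [hlog]; linarith
  have hlt0 : 0 ≤ Real.log t := Real.log_nonneg (by linarith)
  have hlt2 : Real.log t ^ 2 ≤ (10.4 * s) ^ 2 := pow_le_pow_left₀ hlt0 hlt 2
  rw [mul_pow, hs2] at hlt2
  linarith

theorem theta_x0 : 32508 ≤ Chebyshev.theta 32768 := by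
  rw [Chebyshev.theta_eq_log_primorial]
  have hf : ⌊(32768 : ℝ)⌋₊ = 32768 := by exact_mod_cast Nat.floor_natCast (R := ℝ) 32768
  rw [hf]
  have h := computed.2.2
  have hR : ((2 : ℝ) ^ 46900) ≤ (primorial 32768 : ℝ) := by exact_mod_cast h
  have hl := Real.log_le_log (by positivity) hR
  rw [Real.log_pow] at hl
  have b2 := Real.log_two_gt_d9
  refine le_trans ?_ hl
  push_cast
  linarith

theorem deriv_F (t : ℝ) (ht : 1 < t) :
    HasDerivAt (fun t => 0.13956 * (t / Real.log t))
      (0.13956 * ((Real.log t - 1) / Real.log t ^ 2)) t := by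
  have h0 : t ≠ 0 := by linarith
  have hl : Real.log t ≠ 0 := (Real.log_pos ht).ne'
  have := ((hasDerivAt_id t).div (Real.hasDerivAt_log h0) hl).const_mul 0.13956
  have e : (1 * Real.log t - id t * t⁻¹) = Real.log t - 1 := by
    rw [id, mul_inv_cancel₀ h0, one_mul]
  rw [e] at this
  exact this

theorem integral_bound (x : ℝ) (hx : 32768 ≤ x) :
    ∫ t in (32768 : ℝ)..x, Chebyshev.theta t / (t * Real.log t ^ 2) ≤
      0.13956 * (x / Real.log x) - 0.13956 * (32768 / Real.log 32768) := by
  have hcont : ContinuousOn (fun t : ℝ => 0.13956 * ((Real.log t - 1) / Real.log t ^ 2))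
      (Set.uIcc 32768 x) := by
    intro t ht
    rw [Set.uIcc_of_le hx] at ht
    have h0 : t ≠ 0 := by linarith [ht.1]
    have hl : Real.log t ^ 2 ≠ 0 := pow_ne_zero _ (Real.log_pos (by linarith [ht.1])).ne'
    exact ContinuousAt.continuousWithinAt (by fun_prop (disch := assumption))
  have hii := hcont.intervalIntegrable (μ := MeasureTheory.volume)
  have hF := intervalIntegral.integral_eq_sub_of_hasDerivAt
    (f := fun t : ℝ => 0.13956 * (t / Real.log t)) (a := 32768) (b := x)
    (fun t ht => by
      rw [Set.uIcc_of_le hx] at ht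
      exact deriv_F t (by linarith [ht.1])) hii
  rw [← hF]
  refine intervalIntegral.integral_mono_on hx ?_ hii ?_
  · rw [intervalIntegrable_iff_integrableOn_Icc_of_le hx]
    exact (Chebyshev.integrableOn_theta_div_id_mul_log_sq x).mono_set
      (Set.Icc_subset_Icc_left (by norm_num))
  · intro t ht
    have ht0 : 0 < t := by linarith [ht.1]
    have hlt : 10 ≤ Real.log t := by
      have := Real.log_le_log (by norm_num) ht.1
      rw [log_x0] at this
      linarith [Real.log_two_gt_d9]
    have hθ := theta_bound t ht.1
    have hp : 0 < Real.log t ^ 2 := by positivity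
    rw [← mul_div_assoc, div_le_div_iff₀ (by positivity) hp]
    have : Chebyshev.theta t ≤ 0.13956 * (Real.log t - 1) * t := by nlinarith
    nlinarith [mul_le_mul_of_nonneg_right this hp.le]

theorem large_case (x : ℝ) (hx : 32768 ≤ x) :
    (Nat.primeCounting ⌊x⌋₊ : ℝ) ≤ 1.25506 * x / Real.log x := by
  have h1 := Chebyshev.primeCounting_eq_theta_div_log_add_integral (x := x) (by linarith)
  have h0 := Chebyshev.primeCounting_eq_theta_div_log_add_integral (x := 32768) (by norm_num)
  have hf : ⌊(32768 : ℝ)⌋₊ = 32768 := by exact_mod_cast Nat.floor_natCast (R := ℝ) 32768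
  rw [hf] at h0
  have hint : ∀ a b : ℝ, 2 ≤ a → a ≤ b → IntervalIntegrable
      (fun t => Chebyshev.theta t / (t * Real.log t ^ 2)) MeasureTheory.volume a b := by
    intro a b ha hab
    rw [intervalIntegrable_iff_integrableOn_Icc_of_le hab]
    exact (Chebyshev.integrableOn_theta_div_id_mul_log_sq b).mono_set
      (Set.Icc_subset_Icc_left ha)
  have hadd := intervalIntegral.integral_add_adjacent_intervals
    (hint 2 32768 le_rfl (by norm_num)) (hint 32768 x (by norm_num) hx)
  have hI := integral_bound x hx
  have hθ := theta_bound x hx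
  have hθ0 := theta_x0
  have hπ : (Nat.primeCounting 32768 : ℝ) ≤ 3512 := by exact_mod_cast computed.2.1
  have hlx : 0 < Real.log x := Real.log_pos (by linarith)
  have hl0 : 0 < Real.log 32768 := Real.log_pos (by norm_num)
  have hq : Chebyshev.theta x / Real.log x ≤ 1.1155 * (x / Real.log x) := by
    rw [← mul_div_assoc]
    exact div_le_div_of_nonneg_right hθ hlx.le
  have hk : (Nat.primeCounting 32768 : ℝ) ≤
      Chebyshev.theta 32768 / Real.log 32768 + 0.13956 * (32768 / Real.log 32768) := by
    refine hπ.trans ?_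
    rw [← mul_div_assoc, ← add_div, le_div_iff₀ hl0, log_x0]
    linarith [Real.log_two_lt_d9]
  rw [mul_div_assoc]
  linarith

end PCU

/-- Rosser–Schoenfeld upper bound: for every real `m > 1`, the number of primes
not exceeding `m` is at most `1.25506·m / log m`. -/
theorem primeCounting_upper (m : ℝ) (hm : 1 < m) :
    (Nat.primeCounting ⌊m⌋₊ : ℝ) ≤ 1.25506 * m / Real.log m := by
  rcases le_total m 32768 with h | h
  · rw [le_div_iff₀ (Real.log_pos hm)]
    exact PCU.small_case m hm h
  · exact PCU.large_case m h
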